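/- Let (T(t))_{t>0} be a positive semigroup of kernel operators on a Polish space E, bounded by a constant M, which enjoys the strong Feller property, and assume that for every λ > 0 the operator R(λ) of its Laplace transform is injective when restricted to C_b(E), i.e. if f, g ∈ C_b(E) and R(λ)f = R(λ)g then f = g. Then for every f ∈ B_b(E) the map (t,x) ↦ (T(t)f)(x) is jointly continuous on (0,∞) × E. -/

import Mathlib

open MeasureTheory Filter Topology

/-- `f` is a bounded Borel measurable real-valued function. -/
def IsBb {E : Type*} [MeasurableSpace E] (f : E → ℝ) : Prop :=
  Measurable f ∧ ∃ C : ℝ, ∀ x, |f x| ≤ C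

/-- `f` is a bounded continuous real-valued function. -/
def IsCb {E : Type*} [TopologicalSpace E] (f : E → ℝ) : Prop :=
  Continuous f ∧ ∃ C : ℝ, ∀ x, |f x| ≤ C

/-- The kernel operator associated with a kernel `k : E → Measure E`. -/
noncomputable def kOp {E : Type*} [MeasurableSpace E] (k : E → Measure E) (f : E → ℝ) (x : E) : ℝ :=
  ∫ y, f y ∂(k x)

/-- `(k t)_{t>0}` is a positive semigroup of kernels on `E`, bounded by `M`:
measurability in `x`, total mass bounded by `M`, Chapman–Kolmogorov, and joint
measurability of `(t,x) ↦ (T(t)f)(x)` on `(0,∞) × E` for bounded measurable `f`. -/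
def IsKernelSemigroup {E : Type*} [MeasurableSpace E] (k : ℝ → E → Measure E) (M : NNReal) : Prop :=
  (∀ t, 0 < t → ∀ A : Set E, MeasurableSet A → Measurable fun x => k t x A) ∧
  (∀ t, 0 < t → ∀ x, k t x Set.univ ≤ (M : ENNReal)) ∧
  (∀ t, 0 < t → ∀ s, 0 < s → ∀ x, ∀ A : Set E, MeasurableSet A →
    k (t + s) x A = ∫⁻ y, k s y A ∂(k t x)) ∧
  (∀ f : E → ℝ, IsBb f → Measurable fun p : Set.Ioi (0:ℝ) × E => kOp (k p.1.1) f p.2)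

/-- The Laplace transform (pseudo-resolvent) of the semigroup of kernel operators. -/
noncomputable def laplaceOp {E : Type*} [MeasurableSpace E]
    (k : ℝ → E → Measure E) (l : ℝ) (f : E → ℝ) (x : E) : ℝ :=
  ∫ t in Set.Ioi (0:ℝ), Real.exp (-l * t) * kOp (k t) f x

/-- Bounded sequences of measurable functions have subsequences that converge weakly against
all integrable functions. -/
theorem exists_subseq_tendsto_integral_mul {E : Type*} [MeasurableSpace E]
    [MeasurableSpace.CountablyGenerated E] (ν : Measure E) [IsFiniteMeasure ν]
    (g : ℕ → E → ℝ) (hg : ∀ n, Measurable (g n)) (C : ℝ) (hC : ∀ n x, |g n x| ≤ C) :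
    ∃ φ : ℕ → ℕ, StrictMono φ ∧ ∀ p : E → ℝ, Integrable p ν →
      ∃ c : ℝ, Tendsto (fun n => ∫ y, p y * g (φ n) y ∂ν) atTop (𝓝 c) := by
  have hmul (n : ℕ) {p : E → ℝ} (hp : Integrable p ν) : Integrable (fun y => p y * g n y) ν :=
    hp.mul_bdd (hg n).aestronglyMeasurable (Eventually.of_forall (hC n))
  have : Fact ((1 : ENNReal) ≠ ⊤) := ⟨ENNReal.one_ne_top⟩
  let L (n : ℕ) : Lp ℝ 1 ν →L[ℝ] ℝ := LinearMap.mkContinuous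
    { toFun := fun p => ∫ y, p y * g n y ∂ν
      map_add' := fun p q => by
        rw [← integral_add (hmul n (L1.integrable_coeFn p)) (hmul n (L1.integrable_coeFn q))]
        refine integral_congr_ae ?_
        filter_upwards [Lp.coeFn_add p q] with y hy
        rw [hy, Pi.add_apply, add_mul]
      map_smul' := fun c p => by
        rw [RingHom.id_apply, smul_eq_mul, ← integral_const_mul]
        refine integral_congr_ae ?_
        filter_upwards [Lp.coeFn_smul c p] with y hy
        rw [hy, Pi.smul_apply, smul_eq_mul, mul_assoc] } C
    (fun p => by
      rw [LinearMap.coe_mk, AddHom.coe_mk, L1.norm_eq_integral_norm, ← integral_const_mul]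
      refine norm_integral_le_of_norm_le ((L1.integrable_coeFn p).norm.const_mul C)
        (Eventually.of_forall fun y => ?_)
      rw [norm_mul, mul_comm]
      exact mul_le_mul_of_nonneg_right (hC n y) (norm_nonneg _))
  have hL (n : ℕ) : ‖L n‖ ≤ max C 0 := LinearMap.mkContinuous_norm_le' _ _
  obtain ⟨l, -, φ, hφ, hl⟩ := WeakDual.isSeqCompact_closedBall ℝ (Lp ℝ 1 ν) 0 (max C 0)
    (x := fun n => StrongDual.toWeakDual (L n)) (fun n => by simpa using hL n)
  refine ⟨φ, hφ, fun p hp => ⟨l (hp.toL1 p), ?_⟩⟩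
  have h := tendsto_iff_forall_eval_tendsto_topDualPairing.1 hl (hp.toL1 p)
  refine h.congr fun n => ?_
  change ∫ y, hp.toL1 p y * g (φ n) y ∂ν = _
  refine integral_congr_ae ?_
  filter_upwards [hp.coeFn_toL1] with y hy
  rw [hy]

theorem IsBb.integrable {E : Type*} [MeasurableSpace E] {f : E → ℝ} (hf : IsBb f)
    (μ : Measure E) [IsFiniteMeasure μ] : Integrable f μ := by
  obtain ⟨hm, C, hC⟩ := hf
  exact Integrable.of_bound hm.aestronglyMeasurable C (Eventually.of_forall hC)

/-- The operators of a family of finite measures with the strong Feller property are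
dominated by a single finite measure. -/
theorem exists_dominating_measure {E : Type*} [TopologicalSpace E] [PolishSpace E]
    [MeasurableSpace E] [BorelSpace E] (k : E → Measure E) [∀ x, IsFiniteMeasure (k x)]
    (hsf : ∀ f : E → ℝ, IsBb f → IsCb (kOp k f)) :
    ∃ ν : Measure E, IsFiniteMeasure ν ∧ ∀ x, k x ≪ ν := by
  rcases isEmpty_or_nonempty E with hE | hE
  · exact ⟨0, inferInstance, fun x => hE.elim x⟩
  let ν : Measure E := Measure.sum fun n => k (TopologicalSpace.denseSeq E n)
  refine ⟨ν.toFinite, inferInstance, fun x =>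
    Measure.AbsolutelyContinuous.trans ?_ (absolutelyContinuous_toFinite ν)⟩
  refine Measure.AbsolutelyContinuous.mk fun A hA h0 => ?_
  have hop (x : E) : kOp k (A.indicator 1) x = (k x).real A := integral_indicator_one hA
  have hcont : Continuous (kOp k (A.indicator 1)) := by
    refine (hsf _ ⟨measurable_one.indicator hA, 1, fun y => ?_⟩).1
    by_cases hy : y ∈ A <;> simp [hy]
  have hzero : kOp k (A.indicator 1) = fun _ => 0 := by
    refine hcont.ext_on (TopologicalSpace.denseRange_denseSeq E) continuous_const ?_
    rintro _ ⟨n, rfl⟩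
    rw [hop, measureReal_def, Measure.sum_apply_eq_zero.1 h0 n, ENNReal.toReal_zero]
  rw [← measureReal_eq_zero_iff, ← hop, hzero]

theorem abs_kOp_le {E : Type*} [MeasurableSpace E] {k : E → Measure E} {M : NNReal} {x : E}
    (hM : k x Set.univ ≤ M) {f : E → ℝ} {C : ℝ} (hC : ∀ y, |f y| ≤ C) :
    |kOp k f x| ≤ C * M := by
  have : IsFiniteMeasure (k x) := ⟨hM.trans_lt ENNReal.coe_lt_top⟩
  have hC0 : 0 ≤ C := (abs_nonneg _).trans (hC x)
  refine (norm_integral_le_of_norm_le_const (f := f) (C := C) (Eventually.of_forall hC)).trans ?_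
  exact mul_le_mul_of_nonneg_left (ENNReal.toReal_mono ENNReal.coe_ne_top hM) hC0

/-- A strong Feller operator maps bounded sequences to sequences with pointwise convergent
subsequences. -/
theorem exists_subseq_tendsto_kOp {E : Type*} [TopologicalSpace E] [PolishSpace E]
    [MeasurableSpace E] [BorelSpace E] (k : E → Measure E) [∀ x, IsFiniteMeasure (k x)]
    (hsf : ∀ f : E → ℝ, IsBb f → IsCb (kOp k f))
    (g : ℕ → E → ℝ) (hg : ∀ n, Measurable (g n)) (C : ℝ) (hC : ∀ n x, |g n x| ≤ C) :
    ∃ φ : ℕ → ℕ, StrictMono φ ∧ ∃ h : E → ℝ, ∀ x,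
      Tendsto (fun n => kOp k (g (φ n)) x) atTop (𝓝 (h x)) := by
  obtain ⟨ν, hν, hac⟩ := exists_dominating_measure k hsf
  obtain ⟨φ, hφ, hlim⟩ := exists_subseq_tendsto_integral_mul ν g hg C hC
  choose h hh using fun x => hlim (fun y => ((k x).rnDeriv ν y).toReal)
    Measure.integrable_toReal_rnDeriv
  refine ⟨φ, hφ, h, fun x => (hh x).congr fun n => ?_⟩
  exact integral_toReal_rnDeriv_mul (hac x)

/-- A strong Feller operator turns bounded pointwise convergence into continuous convergence. -/
theorem tendsto_kOp_of_tendsto {E : Type*} [TopologicalSpace E]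
    [MeasurableSpace E] (k : E → Measure E) [∀ x, IsFiniteMeasure (k x)]
    (hsf : ∀ f : E → ℝ, IsBb f → IsCb (kOp k f))
    (h : ℕ → E → ℝ) (hm : ∀ n, Measurable (h n)) (C : ℝ) (hC : ∀ n x, |h n x| ≤ C)
    (h' : E → ℝ) (hlim : ∀ y, Tendsto (fun n => h n y) atTop (𝓝 (h' y)))
    (x : ℕ → E) (x' : E) (hx : Tendsto x atTop (𝓝 x')) :
    Tendsto (fun n => kOp k (h n) (x n)) atTop (𝓝 (kOp k h' x')) := by
  have hm' : Measurable h' := measurable_of_tendsto_metrizable hm (tendsto_pi_nhds.2 hlim)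
  have hC' (y : E) : |h' y| ≤ C := le_of_tendsto (hlim y).abs (Eventually.of_forall fun n => hC n y)
  have hb (n : ℕ) : IsBb (h n) := ⟨hm n, C, hC n⟩
  have hb' : IsBb h' := ⟨hm', C, hC'⟩
  have hd (n : ℕ) (y : E) : |h n y - h' y| ≤ 2 * C := by
    have := abs_sub (h n y) (h' y); linarith [hC n y, hC' y]
  have hbdd (m : ℕ) (y : E) : BddAbove (Set.range fun j => |h (m + j) y - h' y|) :=
    ⟨2 * C, by rintro _ ⟨j, rfl⟩; exact hd _ y⟩
  let H (m : ℕ) (y : E) : ℝ := ⨆ j, |h (m + j) y - h' y|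
  have hH0 (m : ℕ) (y : E) : 0 ≤ H m y := Real.iSup_nonneg fun _ => abs_nonneg _
  have hHC (m : ℕ) (y : E) : |H m y| ≤ 2 * C := by
    rw [abs_of_nonneg (hH0 m y)]
    exact ciSup_le fun j => hd _ y
  have hHm (m : ℕ) : Measurable (H m) :=
    Measurable.iSup fun j => ((hm _).sub hm').abs
  have hHlim (y : E) : Tendsto (fun m => H m y) atTop (𝓝 0) := by
    have h0 : Tendsto (fun n => |h n y - h' y|) atTop (𝓝 0) := by
      simpa using ((hlim y).sub_const (h' y)).abs
    refine Metric.tendsto_atTop.2 fun ε hε => ?_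
    obtain ⟨N, hN⟩ := Metric.tendsto_atTop.1 h0 (ε / 2) (half_pos hε)
    refine ⟨N, fun n hn => ?_⟩
    rw [Real.dist_eq, sub_zero, abs_of_nonneg (hH0 n y)]
    refine lt_of_le_of_lt (ciSup_le fun j => ?_) (half_lt_self hε)
    have := hN (n + j) (by lia)
    rw [Real.dist_eq, sub_zero, abs_abs] at this
    exact this.le
  have hkH : Tendsto (fun m => kOp k (H m) x') atTop (𝓝 0) := by
    have := tendsto_integral_of_dominated_convergence (μ := k x') (F := H) (f := fun _ => 0)
      (fun _ => 2 * C) (fun m => (hHm m).aestronglyMeasurable) (integrable_const _)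
      (fun m => Eventually.of_forall (hHC m)) (Eventually.of_forall hHlim)
    rwa [integral_zero] at this
  have hdiff : Tendsto (fun n => kOp k (h n) (x n) - kOp k h' (x n)) atTop (𝓝 0) := by
    refine Metric.tendsto_atTop.2 fun ε hε => ?_
    obtain ⟨m, hmε⟩ := (hkH.eventually (gt_mem_nhds hε)).exists
    have hcont : Tendsto (fun n => kOp k (H m) (x n)) atTop (𝓝 (kOp k (H m) x')) :=
      ((hsf (H m) ⟨hHm m, _, hHC m⟩).1.tendsto x').comp hx
    obtain ⟨N, hN⟩ := eventually_atTop.1 (hcont.eventually (gt_mem_nhds hmε))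
    refine ⟨max N m, fun n hn => ?_⟩
    rw [Real.dist_eq, sub_zero]
    refine lt_of_le_of_lt ?_ (hN n ((le_max_left _ _).trans hn))
    have hsub : kOp k (h n) (x n) - kOp k h' (x n) = ∫ y, h n y - h' y ∂(k (x n)) :=
      (integral_sub ((hb n).integrable _) (hb'.integrable _)).symm
    rw [hsub, ← Real.norm_eq_abs]
    refine norm_integral_le_of_norm_le (IsBb.integrable ⟨hHm m, _, hHC m⟩ _)
      (Eventually.of_forall fun y => ?_)
    obtain ⟨j, rfl⟩ := Nat.exists_eq_add_of_le ((le_max_right N m).trans hn)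
    exact le_ciSup (hbdd m y) j
  have hfix : Tendsto (fun n => kOp k h' (x n)) atTop (𝓝 (kOp k h' x')) :=
    ((hsf h' hb').1.tendsto x').comp hx
  simpa using hdiff.add hfix

namespace IsKernelSemigroup

variable {E : Type*} [MeasurableSpace E] {k : ℝ → E → Measure E} {M : NNReal}

theorem isFiniteMeasure (hsg : IsKernelSemigroup k M) {t : ℝ} (ht : 0 < t) (x : E) :
    IsFiniteMeasure (k t x) :=
  ⟨(hsg.2.1 t ht x).trans_lt ENNReal.coe_lt_top⟩

theorem kOp_add (hsg : IsKernelSemigroup k M) {t s : ℝ} (ht : 0 < t) (hs : 0 < s)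
    {f : E → ℝ} (hf : IsBb f) (x : E) : kOp (k (t + s)) f x = kOp (k t) (kOp (k s) f) x := by
  let κ (r : ℝ) (hr : 0 < r) : ProbabilityTheory.Kernel E E :=
    ⟨k r, Measure.measurable_of_measurable_coe _ (hsg.1 r hr)⟩
  have hcomp : k (t + s) x = (κ s hs).comp (κ t ht) x := by
    ext A hA
    rw [ProbabilityTheory.Kernel.comp_apply' _ _ _ hA]
    exact hsg.2.2.1 t ht s hs x A hA
  have := hsg.isFiniteMeasure (add_pos ht hs) x
  have hint := hf.integrable (k (t + s) x)
  rw [hcomp] at hint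
  rw [kOp, hcomp, ProbabilityTheory.Kernel.integral_comp hint]
  rfl

theorem aestronglyMeasurable_orbit (hsg : IsKernelSemigroup k M) {f : E → ℝ} (hf : IsBb f)
    (x : E) : AEStronglyMeasurable (fun t => kOp (k t) f x) (volume.restrict (Set.Ioi 0)) := by
  refine (aemeasurable_restrict_of_measurable_subtype measurableSet_Ioi ?_).aestronglyMeasurable
  exact (hsg.2.2.2 f hf).comp (measurable_id.prodMk measurable_const)

theorem isBb_kOp (hsg : IsKernelSemigroup k M) {f : E → ℝ} (hf : IsBb f) {t : ℝ} (ht : 0 < t) :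
    IsBb (kOp (k t) f) := by
  obtain ⟨C, hC⟩ := hf.2
  let t' : Set.Ioi (0 : ℝ) := ⟨t, ht⟩
  exact ⟨(hsg.2.2.2 f hf).comp ((measurable_const (a := t')).prodMk measurable_id),
    C * M, fun x => abs_kOp_le (hsg.2.1 t ht x) hC⟩

/-- The Laplace transform at `1` of a translated orbit is an integral of the orbit itself. -/
theorem laplaceOp_kOp (hsg : IsKernelSemigroup k M) {f : E → ℝ} (hf : IsBb f) {s : ℝ}
    (hs : 0 < s) (x : E) :
    laplaceOp k 1 (kOp (k s) f) x =
      ∫ t in Set.Ioi 0, (Set.Ioi s).indicator (fun t => Real.exp (s - t) * kOp (k t) f x) t := by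
  have hsub : Set.Ioi s ⊆ Set.Ioi 0 := Set.Ioi_subset_Ioi hs.le
  rw [setIntegral_indicator measurableSet_Ioi, Set.inter_eq_right.2 hsub,
    ← integral_indicator measurableSet_Ioi, ← integral_add_right_eq_self _ s,
    laplaceOp, ← integral_indicator measurableSet_Ioi]
  refine integral_congr_ae (Eventually.of_forall fun t => ?_)
  by_cases ht : 0 < t
  · simp [Set.indicator, ht, hsg.kOp_add ht hs hf]
  · simp [Set.indicator, ht]

theorem tendsto_laplaceOp_of_tendsto_time (hsg : IsKernelSemigroup k M) {f : E → ℝ} (hf : IsBb f)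
    {s : ℕ → ℝ} (hs : ∀ n, 0 < s n) {s' : ℝ} (hs' : 0 < s') (hlim : Tendsto s atTop (𝓝 s'))
    (x : E) :
    Tendsto (fun n => laplaceOp k 1 (kOp (k (s n)) f) x) atTop
      (𝓝 (laplaceOp k 1 (kOp (k s') f) x)) := by
  obtain ⟨C, hC⟩ := hf.2
  obtain ⟨S, hS⟩ := hlim.bddAbove_range
  simp_rw [fun n => hsg.laplaceOp_kOp hf (hs n) x, hsg.laplaceOp_kOp hf hs' x]
  refine tendsto_integral_of_dominated_convergence
    (fun t => Real.exp S * Real.exp (-t) * (C * M)) (fun n => ?_) ?_ (fun n => ?_) ?_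
  · exact (((by fun_prop : Continuous fun t => Real.exp (s n - t)).aestronglyMeasurable).mul
      (hsg.aestronglyMeasurable_orbit hf x)).indicator measurableSet_Ioi
  · exact ((integrableOn_exp_neg_Ioi 0).const_mul _).mul_const _
  · filter_upwards [ae_restrict_mem measurableSet_Ioi] with t ht
    refine (norm_indicator_le_norm_self _ _).trans ?_
    have hb := abs_kOp_le (hsg.2.1 t ht x) hC
    rw [norm_mul, Real.norm_of_nonneg (Real.exp_pos _).le, ← Real.exp_add]
    refine mul_le_mul (Real.exp_le_exp.2 ?_) hb (norm_nonneg _) (Real.exp_pos _).le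
    linarith [hS (Set.mem_range_self n)]
  · have hne : ∀ᵐ t ∂(volume.restrict (Set.Ioi (0 : ℝ))), t ≠ s' :=
      ae_restrict_of_ae (Measure.ae_ne volume s')
    filter_upwards [hne] with t ht
    rcases lt_or_gt_of_ne ht with h | h
    · refine tendsto_const_nhds.congr' ?_
      filter_upwards [hlim.eventually (lt_mem_nhds h)] with n hn
      simp [Set.indicator, not_lt.2 hn.le, not_lt.2 h.le]
    · have hexp : Tendsto (fun n => Real.exp (s n - t) * kOp (k t) f x) atTop
          (𝓝 (Real.exp (s' - t) * kOp (k t) f x)) :=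
        ((Real.continuous_exp.tendsto _).comp (hlim.sub_const t)).mul_const _
      rw [Set.indicator_of_mem (Set.mem_Ioi.2 h)]
      refine hexp.congr' ?_
      filter_upwards [hlim.eventually (gt_mem_nhds h)] with n hn
      rw [Set.indicator_of_mem (Set.mem_Ioi.2 hn)]

theorem tendsto_laplaceOp_of_tendsto (hsg : IsKernelSemigroup k M) {u : ℕ → E → ℝ} {C : ℝ}
    (hm : ∀ n, Measurable (u n)) (hC : ∀ n x, |u n x| ≤ C) {g : E → ℝ}
    (hlim : ∀ y, Tendsto (fun n => u n y) atTop (𝓝 (g y))) (x : E) :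
    Tendsto (fun n => laplaceOp k 1 (u n) x) atTop (𝓝 (laplaceOp k 1 g x)) := by
  refine tendsto_integral_of_dominated_convergence
    (fun t => Real.exp (-t) * (C * M)) (fun n => ?_) ?_ (fun n => ?_) ?_
  · exact ((by fun_prop : Continuous fun t : ℝ => Real.exp (-1 * t)).aestronglyMeasurable).mul
      (hsg.aestronglyMeasurable_orbit ⟨hm n, C, hC n⟩ x)
  · exact (integrableOn_exp_neg_Ioi 0).mul_const _
  · filter_upwards [ae_restrict_mem measurableSet_Ioi] with t ht
    rw [norm_mul, Real.norm_of_nonneg (Real.exp_pos _).le, neg_one_mul]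
    exact mul_le_mul_of_nonneg_left (abs_kOp_le (hsg.2.1 t ht x) (hC n)) (Real.exp_pos _).le
  · filter_upwards [ae_restrict_mem measurableSet_Ioi] with t ht
    have := hsg.isFiniteMeasure ht x
    refine Tendsto.const_mul _ ?_
    exact tendsto_integral_of_dominated_convergence (fun _ => C)
      (fun n => (hm n).aestronglyMeasurable) (integrable_const _)
      (fun n => Eventually.of_forall (hC n)) (Eventually.of_forall hlim)

end IsKernelSemigroup

/-- If a bounded positive semigroup of kernel operators enjoys the strong Feller
property and its Laplace transform is injective on `C_b(E)`, then the orbit maps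
`(t,x) ↦ (T(t)f)(x)` are jointly continuous on `(0,∞) × E` for every bounded
measurable `f`. -/
theorem joint_continuity_of_strong_feller_semigroup
    {E : Type*} [TopologicalSpace E] [PolishSpace E] [MeasurableSpace E] [BorelSpace E]
    (k : ℝ → E → Measure E) (M : NNReal)
    (hsg : IsKernelSemigroup k M)
    (hsf : ∀ t, 0 < t → ∀ f : E → ℝ, IsBb f → IsCb (kOp (k t) f))
    (hinj : ∀ l : ℝ, 0 < l → ∀ f g : E → ℝ, IsCb f → IsCb g →
      laplaceOp k l f = laplaceOp k l g → f = g) :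
    ∀ f : E → ℝ, IsBb f →
      ContinuousOn (fun p : ℝ × E => kOp (k p.1) f p.2)
        (Set.Ioi (0 : ℝ) ×ˢ (Set.univ : Set E)) := by
  intro f hf
  obtain ⟨C, hC⟩ := hf.2
  have key (a : ℝ) (ha : 0 < a) :
      Continuous fun p : Set.Ioi (a + a) × E => kOp (k p.1) f p.2 := by
    refine continuous_iff_seqContinuous.2 fun p q hpq => ?_
    have htime : Tendsto (fun n => ((p n).1 : ℝ)) atTop (𝓝 q.1) :=
      ((continuous_subtype_val.comp continuous_fst).tendsto q).comp hpq
    have hpos (r : Set.Ioi (a + a)) : 0 < (r : ℝ) - (a + a) := sub_pos.2 r.2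
    have hpos' (r : Set.Ioi (a + a)) : 0 < (r : ℝ) := (add_pos ha ha).trans r.2
    have hfin (x : E) : IsFiniteMeasure (k a x) := hsg.isFiniteMeasure ha x
    refine tendsto_of_subseq_tendsto fun ns hns => ?_
    have htime' := htime.comp hns
    have hsplit (r : Set.Ioi (a + a)) (x : E) : kOp (k r) f x =
        kOp (k a) (kOp (k a) (kOp (k (r - (a + a))) f)) x := by
      rw [← hsg.kOp_add ha ha (hsg.isBb_kOp hf (hpos r)),
        ← hsg.kOp_add (add_pos ha ha) (hpos r) hf, add_sub_cancel]
    let g (n : ℕ) : E → ℝ := kOp (k ((p (ns n)).1 - (a + a))) f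
    have hg (n : ℕ) : IsBb (g n) := hsg.isBb_kOp hf (hpos _)
    have hgC (n : ℕ) (x : E) : |g n x| ≤ C * M := abs_kOp_le (hsg.2.1 _ (hpos _) x) hC
    obtain ⟨φ, hφ, h, hh⟩ := exists_subseq_tendsto_kOp (k a) (hsf a ha) g (fun n => (hg n).1)
      (C * M) hgC
    have hhm (n : ℕ) : IsBb (kOp (k a) (g (φ n))) := hsg.isBb_kOp (hg _) ha
    have hhC (n : ℕ) (x : E) : |kOp (k a) (g (φ n)) x| ≤ C * M * M :=
      abs_kOp_le (hsg.2.1 a ha x) (hgC _)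
    have hbb : IsBb h :=
      ⟨measurable_of_tendsto_metrizable (fun n => (hhm n).1) (tendsto_pi_nhds.2 hh), C * M * M,
        fun y => le_of_tendsto (hh y).abs (Eventually.of_forall fun n => hhC n y)⟩
    have hconv (x : ℕ → E) (x' : E) (hx : Tendsto x atTop (𝓝 x')) :
        Tendsto (fun n => kOp (k (p (ns (φ n))).1) f (x n)) atTop (𝓝 (kOp (k a) h x')) := by
      simp_rw [hsplit]
      exact tendsto_kOp_of_tendsto (k a) (hsf a ha) _ (fun n => (hhm n).1) _ hhC h hh x x' hx
    have hid : kOp (k a) h = kOp (k q.1) f := by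
      refine hinj 1 one_pos _ _ (hsf a ha h hbb) (hsf _ (hpos' _) f hf) (funext fun x => ?_)
      refine tendsto_nhds_unique
        (hsg.tendsto_laplaceOp_of_tendsto (u := fun n => kOp (k (p (ns (φ n))).1) f)
          (fun n => (hsg.isBb_kOp hf (hpos' _)).1)
          (fun n y => abs_kOp_le (hsg.2.1 _ (hpos' _) y) hC)
          (fun y => hconv _ y tendsto_const_nhds) x) ?_
      exact hsg.tendsto_laplaceOp_of_tendsto_time hf (fun n => hpos' _) (hpos' _)
        (htime'.comp hφ.tendsto_atTop) x
    refine ⟨φ, ?_⟩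
    rw [← hid]
    exact hconv _ _ (((continuous_snd.tendsto q).comp hpq).comp (hns.comp hφ.tendsto_atTop))
  rintro ⟨t, x⟩ ⟨ht, -⟩
  have ht : 0 < t := ht
  have hcont : ContinuousOn (fun p : ℝ × E => kOp (k p.1) f p.2)
      (Set.Ioi (t / 4 + t / 4) ×ˢ (Set.univ : Set E)) := by
    rw [continuousOn_iff_continuous_domRestrict]
    exact (key (t / 4) (by linarith)).comp
      (f := fun p : (Set.Ioi (t / 4 + t / 4) ×ˢ (Set.univ : Set E) : Set (ℝ × E)) =>
        ((⟨p.1.1, p.2.1⟩ : Set.Ioi (t / 4 + t / 4)), p.1.2)) (by fun_prop)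
  exact (hcont.continuousAt ((isOpen_Ioi.prod isOpen_univ).mem_nhds
    ⟨by simp only [Set.mem_Ioi]; linarith, Set.mem_univ _⟩)).continuousWithinAt
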